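/- Let d = 1, p ∈ [0,1], t ≥ 1, and let w ≥ 1 be an integer. Let B_o = [−w,w]×[0,t] and ∂B_o = {(x,s) ∈ B_o : s = t or |x| = w}, and let {(o,0) → ∂B_o} be the event that there is a path of occupied bonds from (o,0) lying inside B_o and ending at a vertex of ∂B_o. Then for all integers j ≥ 2 and x with j·w < x ≤ (j+1)·w and x + t even, τ(x,t) ≤ ℙ_p((o,0) → ∂B_o)² · H_p(w,3t)^{j−2}. -/

import Mathlib

/-!
Common set-up: nearest-neighbour oriented bond percolation on the space-time
lattice `ℤ^d × ℕ`.  A (potential) bond is a pair `((x, s), y)`, representing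
the oriented bond from `(x, s)` to `(y, s + 1)` (it is a genuine bond when
`‖x - y‖₁ = 1`).  Each bond is occupied (`true`) with probability `p`,
independently of all other bonds.  The product Bernoulli(`p`) measure on
configurations is constructed explicitly as the pushforward of the uniform
measure on `[0,1)`: the binary digits of a uniform sample are i.i.d. fair
coin flips, which are re-packed (via the pairing function) into an i.i.d.
sequence of uniform random variables `unif i`, one for each bond, and the
bond indexed by `i` is occupied exactly when `unif i < p`.
-/

open MeasureTheory Filter Set
open scoped Classical ENNReal Topology

namespace OrientedPercolation

/-- A potential bond of the `d`-dimensional space-time lattice: `((x, s), y)`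
represents the oriented pair from `(x, s)` to `(y, s + 1)`. -/
abbrev Bond (d : ℕ) := ((Fin d → ℤ) × ℕ) × (Fin d → ℤ)

/-- A bond configuration: each potential bond is occupied (`true`) or vacant (`false`). -/
abbrev Config (d : ℕ) := Bond d → Bool

/-- The ℓ¹-norm of a point of `ℤ^d`. -/
def norm1 {d : ℕ} (x : Fin d → ℤ) : ℤ := ∑ i, |x i|

/-- The squared Euclidean norm of a point of `ℤ^d`. -/
def normSq {d : ℕ} (x : Fin d → ℤ) : ℤ := ∑ i, (x i) ^ 2

/-- The `n`-th binary digit of `x ∈ [0,1)`. -/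
noncomputable def digit (n : ℕ) (x : ℝ) : ℕ := ⌊x * 2 ^ (n + 1)⌋.toNat % 2

/-- From a single uniform sample on `[0,1)`, an i.i.d. sequence of uniform
samples on `[0,1]`, obtained by splitting the binary digits via the pairing
function. -/
noncomputable def unif (i : ℕ) (x : ℝ) : ℝ :=
  ∑' k : ℕ, (digit (Nat.pair i k) x : ℝ) / 2 ^ (k + 1)

/-- An injective encoding of the bonds by natural numbers. -/
noncomputable def enc (d : ℕ) : Bond d → ℕ := (exists_injective_nat (Bond d)).choose

/-- The i.i.d. Bernoulli(`p`) bond configuration built from a uniform sample `x`. -/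
noncomputable def config (d : ℕ) (p : ℝ) (x : ℝ) : Config d :=
  fun b => if unif (enc d b) x < p then true else false

/-- The product Bernoulli(`p`) measure `ℙ_p` on bond configurations. -/
noncomputable def P (d : ℕ) (p : ℝ) : Measure (Config d) :=
  Measure.map (config d p) ((volume : Measure ℝ).restrict (Set.Ico 0 1))

/-- `ConnectedIn ω R x s y t` : either `(x,s) = (y,t) ∈ R`, or there is a path of
occupied bonds from `(x, s)` to `(y, t)`, all of whose vertices lie in `R`. -/
def ConnectedIn {d : ℕ} (ω : Config d) (R : Set ((Fin d → ℤ) × ℕ))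
    (x : Fin d → ℤ) (s : ℕ) (y : Fin d → ℤ) (t : ℕ) : Prop :=
  (x = y ∧ s = t ∧ (x, s) ∈ R) ∨
  (s < t ∧ ∃ v : ℕ → (Fin d → ℤ), v s = x ∧ v t = y ∧
    (∀ j, s ≤ j → j ≤ t → (v j, j) ∈ R) ∧
    (∀ j, s ≤ j → j < t → norm1 (v (j + 1) - v j) = 1 ∧ ω ((v j, j), v (j + 1)) = true))

/-- `(x, s) → (y, t)` : `(x,s) = (y,t)` or there is a path of occupied bonds from
`(x, s)` to `(y, t)`. -/
def Connected {d : ℕ} (ω : Config d) (x : Fin d → ℤ) (s : ℕ) (y : Fin d → ℤ) (t : ℕ) : Prop :=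
  ConnectedIn ω Set.univ x s y t

/-- The survival probability `θ_t = ℙ_p((o,0) → t)`. -/
noncomputable def theta (d : ℕ) (p : ℝ) (t : ℕ) : ℝ :=
  (P d p {ω | ∃ y, Connected ω 0 0 y t}).toReal

/-- The two-point function `τ(x,t) = ℙ_p((o,0) → (x,t))`. -/
noncomputable def tau (d : ℕ) (p : ℝ) (x : Fin d → ℤ) (t : ℕ) : ℝ :=
  (P d p {ω | Connected ω 0 0 x t}).toReal

/-- The expected number of vertices at time `t` connected from the origin,
`χ_t = Σ_x τ(x,t)`. -/
noncomputable def chi (d : ℕ) (p : ℝ) (t : ℕ) : ℝ := ∑' x : Fin d → ℤ, tau d p x t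

/-- The gyration radius `ξ_t = (χ_t⁻¹ Σ_x |x|² τ(x,t))^(1/2)`. -/
noncomputable def xi (d : ℕ) (p : ℝ) (t : ℕ) : ℝ :=
  Real.sqrt ((∑' x : Fin d → ℤ, (normSq x : ℝ) * tau d p x t) / chi d p t)

/-- The critical point `p_c = inf {p ∈ [0,1] : θ_∞ > 0}` (here `θ_∞ = lim_t θ_t = inf_t θ_t`,
since `θ_t` is nonincreasing in `t` and nonnegative). -/
noncomputable def pc (d : ℕ) : ℝ :=
  sInf {p ∈ Set.Icc (0 : ℝ) 1 | 0 < ⨅ t : ℕ, theta d p t}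

/-- The rectangle `[a, b] × [0, t]` (for `d = 1`). -/
def rect (a b : ℤ) (t : ℕ) : Set ((Fin 1 → ℤ) × ℕ) :=
  {v | a ≤ v.1 0 ∧ v.1 0 ≤ b ∧ v.2 ≤ t}

/-- The rectangle `[a, b] × [0, t]` is crossed vertically: there is a path of occupied
bonds inside the rectangle from some vertex `(x, 0)` to some vertex `(y, t)`. -/
def CrossedVert (ω : Config 1) (a b : ℤ) (t : ℕ) : Prop :=
  ∃ x y : Fin 1 → ℤ, ConnectedIn ω (rect a b t) x 0 y t

/-- The rectangle `[a, b] × [0, t]` is crossed from left to right: there is a path of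
occupied bonds inside the rectangle containing a vertex with first coordinate `a` and
a vertex with first coordinate `b`. -/
def CrossedHoriz (ω : Config 1) (a b : ℤ) (t : ℕ) : Prop :=
  ∃ (x y : Fin 1 → ℤ) (s u : ℕ), x 0 = a ∧ y 0 = b ∧
    (ConnectedIn ω (rect a b t) x s y u ∨ ConnectedIn ω (rect a b t) y u x s)

/-- `V_p(w, t) = ℙ_p([0,w] × [0,t] is crossed vertically)`. -/
noncomputable def V (p : ℝ) (w : ℕ) (t : ℕ) : ℝ :=
  (P 1 p {ω | CrossedVert ω 0 w t}).toReal

/-- `H_p(w, t) = ℙ_p([0,w] × [0,t] is crossed from left to right)`. -/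
noncomputable def H (p : ℝ) (w : ℕ) (t : ℕ) : ℝ :=
  (P 1 p {ω | CrossedHoriz ω 0 w t}).toReal

/-- The event that `(o, 0)` is connected, inside the box `B_o = [-w,w] × [0,t]`, to the
boundary `∂B_o = {(x,s) ∈ B_o : s = t or |x| = w}`. -/
def ToBoundary (ω : Config 1) (w : ℕ) (t : ℕ) : Prop :=
  ∃ (y : Fin 1 → ℤ) (s : ℕ), (s = t ∨ |y 0| = w) ∧
    ConnectedIn ω (rect (-(w : ℤ)) w t) 0 0 y s

open ProbabilityTheory

/-- The fair coin on `{0,1} ⊆ ℕ`. -/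
noncomputable def coin : Measure ℕ :=
  (2⁻¹ : ℝ≥0∞) • Measure.dirac 0 + (2⁻¹ : ℝ≥0∞) • Measure.dirac 1

instance coin_prob : IsProbabilityMeasure coin := by
  constructor
  simp [coin, ENNReal.inv_two_add_inv_two]

lemma measurable_digit (n : ℕ) : Measurable (digit n) := by
  unfold digit
  have h1 : Measurable (fun x : ℝ => ⌊x * 2 ^ (n + 1)⌋) :=
    Int.measurable_floor.comp (measurable_id.mul_const _)
  exact (measurable_from_top (f := fun z : ℤ => z.toNat % 2)).comp h1

lemma digit_zero_of {b : ℕ} (hb : b < 2) {x y : ℝ} (hy : y = 2 * x - b) (h0 : 0 ≤ y) (h1 : y < 1) :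
    digit 0 x = b := by
  have : ⌊x * 2 ^ (0 + 1)⌋ = (b : ℤ) := by
    rw [Int.floor_eq_iff]
    push_cast
    constructor <;> linarith
  unfold digit
  rw [this]
  simp
  omega

lemma digit_succ_of {b : ℕ} {x y : ℝ} (hy : y = 2 * x - b) (h0 : 0 ≤ y) (i : ℕ) :
    digit (i + 1) x = digit i y := by
  have h : x * 2 ^ (i + 1 + 1) = y * 2 ^ (i + 1) + ((b * 2 ^ (i + 1) : ℕ) : ℤ) := by
    rw [hy]; push_cast; ring
  unfold digit
  rw [h, Int.floor_add_intCast]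
  have h2 : 0 ≤ ⌊y * 2 ^ (i + 1)⌋ := Int.floor_nonneg.2 (by positivity)
  rw [Int.toNat_add h2 (by positivity), Int.toNat_natCast]
  have h3 : b * 2 ^ (i + 1) = 2 * (b * 2 ^ i) := by ring
  rw [h3]
  omega

lemma digits_prod (n : ℕ) : ∀ S : ℕ → Set ℕ,
    volume {x : ℝ | x ∈ Set.Ico (0 : ℝ) 1 ∧ ∀ i < n, digit i x ∈ S i} =
      ∏ i ∈ Finset.range n, coin (S i) := by
  induction n with
  | zero =>
    intro S
    have : {x : ℝ | x ∈ Set.Ico (0 : ℝ) 1 ∧ ∀ i < 0, digit i x ∈ S i} = Set.Ico (0 : ℝ) 1 := by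
      ext x; simp
    rw [this]; simp
  | succ n ih =>
    intro S
    set A : Set ℝ := {x : ℝ | x ∈ Set.Ico (0 : ℝ) 1 ∧ ∀ i < n, digit i x ∈ S (i + 1)} with hA
    have hAm : MeasurableSet A := by
      have : A = Set.Ico (0:ℝ) 1 ∩ ⋂ i, ⋂ (_ : i < n), digit i ⁻¹' S (i + 1) := by
        ext x; simp [hA]
      rw [this]
      refine measurableSet_Ico.inter (MeasurableSet.iInter fun i => MeasurableSet.iInter fun _ => ?_)
      exact measurable_digit i (MeasurableSet.of_discrete)
    have hAsub : ∀ y ∈ A, 0 ≤ y ∧ y < 1 := fun y hy => hy.1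
    have hAvol := ih (fun i => S (i + 1))
    rw [Finset.prod_range_succ', ← hAvol, ← hA]
    have hB : ∀ b : ℕ, volume {x : ℝ | b ∈ S 0 ∧ 2 * x - b ∈ A} =
        (S 0).indicator 1 b * (2⁻¹ * volume A) := by
      intro b
      by_cases hb : b ∈ S 0
      · have : {x : ℝ | b ∈ S 0 ∧ 2 * x - b ∈ A} = (2 * ·) ⁻¹' ((· - (b:ℝ)) ⁻¹' A) := by
          ext x; simp [hb]
        have hs : volume ((· - (b:ℝ)) ⁻¹' A) = volume A := by
          simpa [sub_eq_add_neg] using measure_preimage_add_right volume (-(b:ℝ)) A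
        rw [this, Real.volume_preimage_mul_left (by norm_num), hs]
        simp [hb]
      · simp [hb]
    have hU : {x : ℝ | x ∈ Set.Ico (0 : ℝ) 1 ∧ ∀ i < n + 1, digit i x ∈ S i} =
        {x : ℝ | 0 ∈ S 0 ∧ 2 * x - (0 : ℕ) ∈ A} ∪ {x : ℝ | 1 ∈ S 0 ∧ 2 * x - (1 : ℕ) ∈ A} := by
      have key : ∀ b : ℕ, b < 2 → ∀ x : ℝ, 0 ≤ 2 * x - b → 2 * x - b < 1 →
          ((∀ i < n + 1, digit i x ∈ S i) ↔ b ∈ S 0 ∧ 2 * x - b ∈ A) := by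
        intro b hb x h0 h1
        rw [Nat.forall_lt_succ_left, digit_zero_of hb rfl h0 h1]
        simp only [digit_succ_of (b := b) (x := x) rfl h0]
        simp [hA, h0, h1, -sub_nonneg]
      ext x
      constructor
      · rintro ⟨⟨hx0, hx1⟩, h⟩
        by_cases hx : 2 * x < 1
        · left
          exact (key 0 (by norm_num) x (by push_cast; linarith) (by push_cast; linarith)).1 h
        · right
          exact (key 1 (by norm_num) x (by push_cast; linarith) (by push_cast; linarith)).1 h
      · rintro (h | h)
        · have := hAsub _ h.2
          push_cast at this
          refine ⟨⟨by linarith, by linarith⟩, (key 0 (by norm_num) x ?_ ?_).2 h⟩ <;>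
            push_cast <;> linarith
        · have := hAsub _ h.2
          push_cast at this
          refine ⟨⟨by linarith, by linarith⟩, (key 1 (by norm_num) x ?_ ?_).2 h⟩ <;>
            push_cast <;> linarith
    rw [hU, measure_union, hB, hB]
    · simp [coin]
      ring
    · rw [Set.disjoint_left]
      rintro x ⟨_, h⟩ ⟨_, h'⟩
      have := hAsub _ h
      have := hAsub _ h'
      push_cast at *
      linarith
    · have : Measurable (fun x : ℝ => 2 * x - ((1:ℕ):ℝ)) := by fun_prop
      exact (MeasurableSet.const _).inter (this hAm)

/-- The uniform measure on `[0,1)`. -/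
noncomputable def U01 : Measure ℝ := (volume : Measure ℝ).restrict (Set.Ico 0 1)

lemma digits_law : U01.map (fun x i => digit i x) = Measure.infinitePi (fun _ : ℕ => coin) := by
  apply Measure.eq_infinitePi
  intro s T hT
  have hm : Measurable (fun (x : ℝ) (i : ℕ) => digit i x) := measurable_pi_iff.2 measurable_digit
  have hs : MeasurableSet (Set.pi (s : Set ℕ) T) :=
    MeasurableSet.pi s.countable_toSet (fun i _ => hT i)
  rw [Measure.map_apply hm hs, U01, Measure.restrict_apply (hm hs)]
  obtain ⟨n, hn⟩ := s.exists_nat_subset_range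
  have := digits_prod n (fun i => if i ∈ s then T i else Set.univ)
  rw [← Finset.prod_subset hn (f := fun i => coin (if i ∈ s then T i else Set.univ))] at this
  · rw [Finset.prod_congr rfl (g := fun i => coin (T i)) (fun i hi => by simp [hi])] at this
    rw [← this]
    congr 1
    ext x
    simp only [Set.mem_inter_iff, Set.mem_preimage, Set.mem_pi, Set.mem_ofPred_eq]
    constructor
    · rintro ⟨h1, h2⟩
      refine ⟨h2, fun i _ => ?_⟩
      split_ifs with hi
      · exact h1 i hi
      · trivial
    · rintro ⟨h1, h2⟩
      refine ⟨fun i hi => ?_, h1⟩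
      have := h2 i (Finset.mem_range.1 (hn hi))
      rwa [if_pos (by exact hi)] at this
  · intro i _ hi
    simp [hi]

/-- Binary expansion. -/
noncomputable def binSum (a : ℕ → ℕ) : ℝ := ∑' k : ℕ, ((a k % 2 : ℕ) : ℝ) / 2 ^ (k + 1)

lemma measurable_binSum : Measurable binSum := by
  have hs : ∀ a : ℕ → ℕ, Summable (fun k : ℕ => ((a k % 2 : ℕ) : ℝ) / 2 ^ (k + 1)) := by
    intro a
    refine Summable.of_nonneg_of_le (fun k => by positivity) (fun k => ?_)
      (summable_geometric_two' 1)
    have : ((a k % 2 : ℕ) : ℝ) ≤ 1 := by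
      have : a k % 2 ≤ 1 := by omega
      exact_mod_cast this
    rw [div_div, pow_succ']
    gcongr
  refine measurable_of_tendsto_metrizable
    (f := fun n (a : ℕ → ℕ) => ∑ k ∈ Finset.range n, ((a k % 2 : ℕ) : ℝ) / 2 ^ (k + 1)) ?_ ?_
  · intro n
    refine Finset.measurable_sum _ (fun k _ => ?_)
    exact (measurable_from_top (f := fun z : ℕ => ((z % 2 : ℕ) : ℝ) / 2 ^ (k + 1))).comp
      (measurable_pi_apply k)
  · rw [tendsto_pi_nhds]
    intro a
    exact (hs a).hasSum.tendsto_sum_nat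

lemma unif_eq (i : ℕ) (x : ℝ) : unif i x = binSum (fun k => digit (Nat.pair i k) x) := by
  unfold unif binSum
  congr 1
  ext k
  congr 2
  simp [digit]

lemma blocks_law : U01.map (fun x (i k : ℕ) => digit (Nat.pair i k) x) =
    Measure.infinitePi (fun _ : ℕ => Measure.infinitePi (fun _ : ℕ => coin)) := by
  have h1 := Measure.map_infinitePi_infinitePi_of_inj (P := fun _ : ℕ => coin)
    (f := fun q : ℕ × ℕ => Nat.pair q.1 q.2) (by
      intro a b h
      have := Nat.pair_eq_pair.1 h
      exact Prod.ext this.1 this.2)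
  rw [← digits_law, Measure.map_map (by fun_prop) (measurable_pi_iff.2 measurable_digit)] at h1
  have h2 := Measure.infinitePi_map_curry (fun _ _ : ℕ => coin)
  rw [← h2, ← h1, Measure.map_map]
  · rfl
  · fun_prop
  · refine measurable_pi_iff.2 fun q => measurable_digit _

/-- The one-bond marginal. -/
noncomputable def bern (p : ℝ) : Measure Bool :=
  (Measure.infinitePi (fun _ : ℕ => coin)).map (fun a => if binSum a < p then true else false)

lemma measurable_bernFun (p : ℝ) :
    Measurable (fun a : ℕ → ℕ => if binSum a < p then true else false) :=
  Measurable.ite (measurableSet_lt measurable_binSum measurable_const)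
    measurable_const measurable_const

instance bern_prob (p : ℝ) : IsProbabilityMeasure (bern p) :=
  Measure.isProbabilityMeasure_map (measurable_bernFun p).aemeasurable

lemma P_eq (d : ℕ) (p : ℝ) : P d p = Measure.infinitePi (fun _ : Bond d => bern p) := by
  have hinj : Function.Injective (enc d) := (exists_injective_nat (Bond d)).choose_spec
  have h1 := Measure.map_infinitePi_infinitePi_of_inj
    (P := fun _ : ℕ => Measure.infinitePi (fun _ : ℕ => coin)) hinj
  have h2 := Measure.infinitePi_map_pi (fun _ : Bond d => Measure.infinitePi (fun _ : ℕ => coin))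
    (f := fun _ a => if binSum a < p then true else false) (fun _ => measurable_bernFun p)
  unfold bern
  have hd : Measurable (fun (x : ℝ) (i k : ℕ) => digit (Nat.pair i k) x) :=
    measurable_pi_iff.2 fun i => measurable_pi_iff.2 fun k => measurable_digit _
  have hb : Measurable (fun (ω : Bond d → ℕ → ℕ) (b : Bond d) =>
      if binSum (ω b) < p then true else false) :=
    measurable_pi_iff.2 fun b => (measurable_bernFun p).comp (measurable_pi_apply b)
  have he : Measurable (fun (ω : ℕ → ℕ → ℕ) (b : Bond d) => ω (enc d b)) := by fun_prop
  rw [← h2, ← h1, ← blocks_law, Measure.map_map he hd, Measure.map_map hb (he.comp hd)]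
  unfold P
  congr 1
  ext x b
  simp [config, unif_eq]

lemma measurableSet_connectedIn {Ω : Type*} {m : MeasurableSpace Ω} {d : ℕ} (F : Ω → Config d)
    (R : Set ((Fin d → ℤ) × ℕ)) (x : Fin d → ℤ) (s : ℕ) (y : Fin d → ℤ) (t : ℕ)
    (hF : ∀ (a : Fin d → ℤ) (r : ℕ) (b : Fin d → ℤ), (a, r) ∈ R → (b, r + 1) ∈ R →
      norm1 (b - a) = 1 → Measurable (fun ω => F ω ((a, r), b))) :
    MeasurableSet {ω | ConnectedIn (F ω) R x s y t} := by
  let ext : (Fin (t + 1) → (Fin d → ℤ)) → ℕ → (Fin d → ℤ) :=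
    fun v j => if h : j < t + 1 then v ⟨j, h⟩ else 0
  have hset : {ω | ConnectedIn (F ω) R x s y t} =
      {_ω | x = y ∧ s = t ∧ (x, s) ∈ R} ∪ ⋃ v : Fin (t + 1) → (Fin d → ℤ),
        {ω | (s < t ∧ ext v s = x ∧ ext v t = y ∧ (∀ j, s ≤ j → j ≤ t → (ext v j, j) ∈ R) ∧
          (∀ j, s ≤ j → j < t → norm1 (ext v (j + 1) - ext v j) = 1)) ∧
          ∀ j, s ≤ j → j < t → F ω ((ext v j, j), ext v (j + 1)) = true} := by
    ext ω
    simp only [Set.mem_union, Set.mem_iUnion, Set.mem_ofPred_eq, ConnectedIn]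
    refine or_congr Iff.rfl ?_
    constructor
    · rintro ⟨hst, v, h1, h2, h3, h4⟩
      refine ⟨fun i => v i, ?_⟩
      have he : ∀ j, j ≤ t → ext (fun i : Fin (t + 1) => v i) j = v j := by
        intro j hj
        exact dif_pos (Nat.lt_succ_of_le hj)
      refine ⟨⟨hst, by rw [he s hst.le, h1], by rw [he t le_rfl, h2], ?_, ?_⟩, ?_⟩
      · intro j hj hjt
        rw [he j hjt]; exact h3 j hj hjt
      · intro j hj hjt
        rw [he j hjt.le, he (j + 1) hjt]; exact (h4 j hj hjt).1
      · intro j hj hjt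
        rw [he j hjt.le, he (j + 1) hjt]; exact (h4 j hj hjt).2
    · rintro ⟨v, ⟨h0, h1, h2, h3, h4⟩, h5⟩
      exact ⟨h0, ext v, h1, h2, h3, fun j hj hjt => ⟨h4 j hj hjt, h5 j hj hjt⟩⟩
  rw [hset]
  refine (MeasurableSet.const _).union (MeasurableSet.iUnion fun v => ?_)
  by_cases hC : (s < t ∧ ext v s = x ∧ ext v t = y ∧ (∀ j, s ≤ j → j ≤ t → (ext v j, j) ∈ R) ∧
          (∀ j, s ≤ j → j < t → norm1 (ext v (j + 1) - ext v j) = 1))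
  · have : {ω | (s < t ∧ ext v s = x ∧ ext v t = y ∧ (∀ j, s ≤ j → j ≤ t → (ext v j, j) ∈ R) ∧
          (∀ j, s ≤ j → j < t → norm1 (ext v (j + 1) - ext v j) = 1)) ∧
          ∀ j, s ≤ j → j < t → F ω ((ext v j, j), ext v (j + 1)) = true} =
        ⋂ j, ⋂ (_ : s ≤ j), ⋂ (_ : j < t),
          (fun ω => F ω ((ext v j, j), ext v (j + 1))) ⁻¹' {true} := by
      ext ω
      simp only [Set.mem_iInter, Set.mem_preimage, Set.mem_singleton_iff, Set.mem_ofPred_eq]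
      exact ⟨fun h => h.2, fun h => ⟨hC, h⟩⟩
    rw [this]
    refine MeasurableSet.iInter fun j => MeasurableSet.iInter fun h1 =>
      MeasurableSet.iInter fun h2 => ?_
    exact hF _ _ _ (hC.2.2.2.1 j h1 h2.le) (hC.2.2.2.1 (j + 1) (by omega) h2)
      (hC.2.2.2.2 j h1 h2) (measurableSet_singleton _)
  · simp only [hC, false_and]
    exact MeasurableSet.const _

lemma measurableSet_toBoundary {Ω : Type*} {m : MeasurableSpace Ω} (F : Ω → Config 1) (w t : ℕ)
    (hF : ∀ (a : Fin 1 → ℤ) (r : ℕ) (b : Fin 1 → ℤ), (a, r) ∈ rect (-(w : ℤ)) w t →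
      (b, r + 1) ∈ rect (-(w : ℤ)) w t →
      norm1 (b - a) = 1 → Measurable (fun ω => F ω ((a, r), b))) :
    MeasurableSet {ω | ToBoundary (F ω) w t} := by
  have : {ω | ToBoundary (F ω) w t} = ⋃ (y : Fin 1 → ℤ), ⋃ (s : ℕ),
      {_ω | s = t ∨ |y 0| = w} ∩ {ω | ConnectedIn (F ω) (rect (-(w : ℤ)) w t) 0 0 y s} := by
    ext ω
    simp [ToBoundary]
  rw [this]
  exact MeasurableSet.iUnion fun y => MeasurableSet.iUnion fun s =>
    (MeasurableSet.const _).inter (measurableSet_connectedIn F _ _ _ _ _ hF)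

lemma measurableSet_crossedHoriz {Ω : Type*} {m : MeasurableSpace Ω} (F : Ω → Config 1)
    (a b : ℤ) (t : ℕ)
    (hF : ∀ (u : Fin 1 → ℤ) (r : ℕ) (v : Fin 1 → ℤ), (u, r) ∈ rect a b t →
      (v, r + 1) ∈ rect a b t →
      norm1 (v - u) = 1 → Measurable (fun ω => F ω ((u, r), v))) :
    MeasurableSet {ω | CrossedHoriz (F ω) a b t} := by
  have : {ω | CrossedHoriz (F ω) a b t} = ⋃ (x : Fin 1 → ℤ), ⋃ (y : Fin 1 → ℤ), ⋃ (s : ℕ),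
      ⋃ (u : ℕ), {_ω | x 0 = a ∧ y 0 = b} ∩ ({ω | ConnectedIn (F ω) (rect a b t) x s y u} ∪
        {ω | ConnectedIn (F ω) (rect a b t) y u x s}) := by
    ext ω
    simp [CrossedHoriz, and_assoc]
  rw [this]
  exact MeasurableSet.iUnion fun x => MeasurableSet.iUnion fun y => MeasurableSet.iUnion fun s =>
    MeasurableSet.iUnion fun u => (MeasurableSet.const _).inter
      ((measurableSet_connectedIn F _ _ _ _ _ hF).union (measurableSet_connectedIn F _ _ _ _ _ hF))

lemma norm1_one (x : Fin 1 → ℤ) : norm1 x = |x 0| := by simp [norm1]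

/-- An open path of length `t` started at time `0`. -/
def IsPath (ω : Config 1) (v : ℕ → (Fin 1 → ℤ)) (t : ℕ) : Prop :=
  ∀ j, j < t → norm1 (v (j + 1) - v j) = 1 ∧ ω ((v j, j), v (j + 1)) = true

lemma IsPath.step {ω : Config 1} {v : ℕ → (Fin 1 → ℤ)} {t : ℕ} (h : IsPath ω v t) (j : ℕ)
    (hj : j < t) : |v (j + 1) 0 - v j 0| = 1 := by
  have := (h j hj).1
  rwa [norm1_one] at this

lemma int_cross (f : ℕ → ℤ) (t : ℕ) (hstep : ∀ j < t, |f (j + 1) - f j| = 1) (a b : ℤ)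
    (hab : a < b) (h0 : f 0 ≤ a) (ht : b ≤ f t) :
    ∃ s u, s < u ∧ u ≤ t ∧ f s = a ∧ f u = b ∧ ∀ i, s ≤ i → i ≤ u → a ≤ f i ∧ f i ≤ b := by
  have hex : ∃ u, b ≤ f u := ⟨t, ht⟩
  set u := Nat.find hex with hu
  have hu1 : b ≤ f u := Nat.find_spec hex
  have hu2 : ∀ i < u, f i < b := fun i hi => not_le.1 (Nat.find_min hex hi)
  have hut : u ≤ t := Nat.find_min' hex ht
  have hu0 : u ≠ 0 := by
    intro h; rw [h] at hu1; omega
  have hfu : f u = b := by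
    have h1 := hu2 (u - 1) (by omega)
    have h2 := hstep (u - 1) (by omega)
    rw [Nat.sub_add_cancel (by omega), abs_eq (by norm_num)] at h2
    omega
  set s := Nat.findGreatest (fun i => f i ≤ a) u with hs
  have hs1 : f s ≤ a := Nat.findGreatest_spec (P := fun i => f i ≤ a) (Nat.zero_le u) h0
  have hsu : s ≤ u := Nat.findGreatest_le u
  have hs2 : ∀ i, s < i → i ≤ u → a < f i := fun i h1 h2 =>
    not_le.1 (Nat.findGreatest_is_greatest (P := fun i => f i ≤ a) h1 h2)
  have hsu' : s < u := by
    rcases hsu.lt_or_eq with h | h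
    · exact h
    · rw [h] at hs1; omega
  have hfs : f s = a := by
    have h1 := hs2 (s + 1) (by omega) (by omega)
    have h2 := hstep s (by omega)
    rw [abs_eq (by norm_num)] at h2
    omega
  refine ⟨s, u, hsu', hut, hfs, hfu, fun i hi1 hi2 => ⟨?_, ?_⟩⟩
  · rcases hi1.lt_or_eq with h | h
    · exact (hs2 i h hi2).le
    · rw [← h, hfs]
  · rcases hi2.lt_or_eq with h | h
    · exact (hu2 i h).le
    · rw [h, hfu]

lemma crossed_of_path {ω : Config 1} {v : ℕ → (Fin 1 → ℤ)} {t : ℕ} (h : IsPath ω v t) (w T : ℕ)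
    (hT : t ≤ T) (hw : 1 ≤ w) (h0 : v 0 0 ≤ 0) (ht : (w : ℤ) ≤ v t 0) :
    CrossedHoriz ω 0 w T := by
  obtain ⟨s, u, hsu, hut, hs, hu, hb⟩ :=
    int_cross (fun j => v j 0) t h.step 0 w (by omega) h0 ht
  refine ⟨v s, v u, s, u, hs, hu, Or.inl (Or.inr ⟨hsu, v, rfl, rfl, ?_, ?_⟩)⟩
  · intro j h1 h2
    exact ⟨(hb j h1 h2).1, (hb j h1 h2).2, by show j ≤ T; omega⟩
  · intro j h1 h2
    exact h j (by omega)

lemma toBoundary_of_path {ω : Config 1} {v : ℕ → (Fin 1 → ℤ)} {t : ℕ} (h : IsPath ω v t) (w : ℕ)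
    (hw : 1 ≤ w) (h0 : v 0 = 0) (ht : (w : ℤ) ≤ |v t 0|) : ToBoundary ω w t := by
  have hex : ∃ u, (w : ℤ) ≤ |v u 0| := ⟨t, ht⟩
  set u := Nat.find hex with hu
  have hu1 : (w : ℤ) ≤ |v u 0| := Nat.find_spec hex
  have hu2 : ∀ i < u, |v i 0| < w := fun i hi => not_le.1 (Nat.find_min hex hi)
  have hut : u ≤ t := Nat.find_min' hex ht
  have hu0 : u ≠ 0 := by
    intro hh; rw [hh, h0] at hu1; simp at hu1; omega
  have hfu : |v u 0| = w := by
    have h1 := hu2 (u - 1) (by omega)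
    have h2 := h.step (u - 1) (by omega)
    rw [Nat.sub_add_cancel (by omega)] at h2
    have h3 := abs_sub_abs_le_abs_sub (v u 0) (v (u - 1) 0)
    omega
  have hle : ∀ i ≤ u, |v i 0| ≤ w := by
    intro i hi
    rcases hi.lt_or_eq with hh | hh
    · exact (hu2 i hh).le
    · rw [hh, hfu]
  refine ⟨v u, u, Or.inr hfu, Or.inr ⟨by omega, v, h0, rfl, ?_, ?_⟩⟩
  · intro j _ h2
    have := abs_le.1 (hle j h2)
    exact ⟨this.1, this.2, by show j ≤ t; omega⟩
  · intro j h1 h2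
    exact h j (by omega)

/-- Spatial translation of bonds. -/
def shiftBond (c : ℤ) (b : Bond 1) : Bond 1 :=
  ((b.1.1 + fun _ => c, b.1.2), b.2 + fun _ => c)

/-- Time reversal (of the bonds in the slab `[0,t]`) together with a spatial translation. -/
def revBond (c : ℤ) (t : ℕ) (b : Bond 1) : Bond 1 :=
  if b.1.2 < t then ((b.2 + fun _ => c, t - 1 - b.1.2), b.1.1 + fun _ => c) else shiftBond c b

lemma shiftBond_inj (c : ℤ) : Function.Injective (shiftBond c) := by
  rintro ⟨⟨a, s⟩, b⟩ ⟨⟨a', s'⟩, b'⟩ h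
  simpa [shiftBond] using h

lemma revBond_inj (c : ℤ) (t : ℕ) : Function.Injective (revBond c t) := by
  rintro ⟨⟨a, s⟩, b⟩ ⟨⟨a', s'⟩, b'⟩ h
  unfold revBond shiftBond at h
  simp only at h
  split_ifs at h with h1 h2 h2 <;> simp only [Prod.mk.injEq, add_left_inj] at h ⊢
  · obtain ⟨⟨h3, h4⟩, h5⟩ := h
    exact ⟨⟨h5, by omega⟩, h3⟩
  · omega
  · omega
  · exact h

lemma P_comp_inj (p : ℝ) {f : Bond 1 → Bond 1} (hf : Function.Injective f) {E : Set (Config 1)}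
    (hE : MeasurableSet E) : P 1 p {ω | (fun b => ω (f b)) ∈ E} = P 1 p E := by
  have h := Measure.map_infinitePi_infinitePi_of_inj (P := fun _ : Bond 1 => bern p) hf
  rw [← P_eq] at h
  conv_rhs => rw [← h]
  rw [Measure.map_apply (by fun_prop) hE]
  rfl

/-- The sigma-algebra generated by the bonds in `S`. -/
def sig (S : Set (Bond 1)) : MeasurableSpace (Config 1) :=
  ⨆ b ∈ S, (⊤ : MeasurableSpace Bool).comap (fun ω : Config 1 => ω b)

lemma measurable_sig {S : Set (Bond 1)} {b : Bond 1} (hb : b ∈ S) :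
    Measurable[sig S] (fun ω : Config 1 => ω b) := by
  have h1 : (⊤ : MeasurableSpace Bool).comap (fun ω : Config 1 => ω b) ≤ sig S :=
    le_iSup₂_of_le b hb le_rfl
  exact (comap_measurable (m := (⊤ : MeasurableSpace Bool)) (fun ω : Config 1 => ω b)).mono h1 le_rfl

lemma sig_mono {S T : Set (Bond 1)} (h : S ⊆ T) : sig S ≤ sig T :=
  biSup_mono h

lemma sig_indep (p : ℝ) {S T : Set (Bond 1)} (h : Disjoint S T) {A B : Set (Config 1)}
    (hA : MeasurableSet[sig S] A) (hB : MeasurableSet[sig T] B) :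
    P 1 p (A ∩ B) = P 1 p A * P 1 p B := by
  have hi : iIndepFun (fun (b : Bond 1) (ω : Config 1) => ω b) (P 1 p) := by
    rw [P_eq]
    exact iIndepFun_infinitePi (X := fun _ x => x) (fun _ => measurable_id)
  rw [iIndepFun_iff_iIndep] at hi
  have := indep_iSup_of_disjoint (fun b => (measurable_pi_apply b).comap_le) hi h
  rw [Indep_iff] at this
  exact this A B hA hB

/-- Bonds to the left of `a`. -/
def Lft (a : ℤ) : Set (Bond 1) := {b | b.1.1 0 ≤ a ∧ b.2 0 ≤ a ∧ norm1 (b.2 - b.1.1) = 1}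

/-- Bonds to the right of `a`. -/
def Rgt (a : ℤ) : Set (Bond 1) := {b | a ≤ b.1.1 0 ∧ a ≤ b.2 0 ∧ norm1 (b.2 - b.1.1) = 1}

lemma disj_LR (a : ℤ) : Disjoint (Lft a) (Rgt a) := by
  rw [Set.disjoint_left]
  rintro b ⟨h1, h2, h3⟩ ⟨h4, h5, _⟩
  rw [norm1_one, Pi.sub_apply, abs_eq (by norm_num)] at h3
  omega

/-- The event that the `k`-th strip `[kw,(k+1)w]` is crossed. -/
def CrossEv (w T k : ℕ) : Set (Config 1) :=
  {ω | CrossedHoriz (fun b => ω (shiftBond ((k : ℤ) * w) b)) 0 w T}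

lemma crossEv_meas (w T k : ℕ) (S : Set (Bond 1))
    (hS : ∀ b : Bond 1, (k : ℤ) * w ≤ b.1.1 0 → (k : ℤ) * w ≤ b.2 0 →
      b.1.1 0 ≤ ((k : ℤ) + 1) * w → b.2 0 ≤ ((k : ℤ) + 1) * w → norm1 (b.2 - b.1.1) = 1 → b ∈ S) :
    MeasurableSet[sig S] (CrossEv w T k) := by
  refine measurableSet_crossedHoriz (m := sig S) _ _ _ _ ?_
  rintro u r v ⟨h1, h2, _⟩ ⟨h3, h4, _⟩ h5
  simp only at h1 h2 h3 h4
  refine measurable_sig (hS _ ?_ ?_ ?_ ?_ ?_)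
  · simp [shiftBond]; omega
  · simp [shiftBond]; omega
  · simp [shiftBond]; linarith
  · simp [shiftBond]; linarith
  · simpa [shiftBond] using h5

/-- Reversed boundary event at `(x,t)`. -/
def RevEv (w t : ℕ) (x : ℤ) : Set (Config 1) :=
  {ω | ToBoundary (fun b => ω (revBond x t b)) w t}

lemma revEv_meas (w t : ℕ) (x a : ℤ) (ha : a + w ≤ x) :
    MeasurableSet[sig (Rgt a)] (RevEv w t x) := by
  refine measurableSet_toBoundary (m := sig (Rgt a)) _ _ _ ?_
  rintro u r v ⟨h1, h2, _⟩ ⟨h3, h4, h6⟩ h5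
  simp only at h1 h2 h3 h4 h6
  have hr : r < t := by omega
  refine measurable_sig ⟨?_, ?_, ?_⟩
  · simp [revBond, hr]; omega
  · simp [revBond, hr]; omega
  · rw [norm1_one] at h5 ⊢
    simp [revBond, hr] at h5 ⊢
    rw [abs_sub_comm]; exact h5

lemma toBoundary_meas (w t : ℕ) (a : ℤ) (ha : (w : ℤ) ≤ a) :
    MeasurableSet[sig (Lft a)] {ω : Config 1 | ToBoundary ω w t} := by
  refine measurableSet_toBoundary (m := sig (Lft a)) (fun ω => ω) _ _ ?_
  rintro u r v ⟨h1, h2, _⟩ ⟨h3, h4, h6⟩ h5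
  simp only at h1 h2 h3 h4 h6
  exact measurable_sig ⟨h2.trans ha, h4.trans ha, h5⟩

lemma P_crossEv (p : ℝ) (w T k : ℕ) : P 1 p (CrossEv w T k) = P 1 p {ω | CrossedHoriz ω 0 w T} :=
  P_comp_inj p (shiftBond_inj _) (E := {ω | CrossedHoriz ω 0 w T})
    (measurableSet_crossedHoriz (fun ω => ω) _ _ _ (fun _ _ _ _ _ _ => measurable_pi_apply _))

lemma P_revEv (p : ℝ) (w t : ℕ) (x : ℤ) : P 1 p (RevEv w t x) = P 1 p {ω | ToBoundary ω w t} :=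
  P_comp_inj p (revBond_inj _ _) (E := {ω | ToBoundary ω w t})
    (measurableSet_toBoundary (fun ω => ω) _ _ (fun _ _ _ _ _ _ => measurable_pi_apply _))

/-- The intersection of the first `n` crossing events with the initial boundary event. -/
def AccEv (w t : ℕ) : ℕ → Set (Config 1)
  | 0 => {ω | ToBoundary ω w t}
  | n + 1 => AccEv w t n ∩ CrossEv w (3 * t) (n + 1)

lemma accEv_meas (w t n : ℕ) : MeasurableSet[sig (Lft (((n : ℤ) + 1) * w))] (AccEv w t n) := by
  induction n with
  | zero => exact toBoundary_meas w t _ (by simp)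
  | succ n ih =>
    refine MeasurableSet.inter ?_ ?_
    · refine sig_mono ?_ _ ih
      rintro b ⟨h1, h2, h3⟩
      push_cast
      exact ⟨by nlinarith, by nlinarith, h3⟩
    · refine crossEv_meas _ _ _ _ ?_
      intro b _ _ h3 h4 h5
      exact ⟨h3, h4, h5⟩

lemma P_accEv (p : ℝ) (w t n : ℕ) : P 1 p (AccEv w t n) =
    P 1 p {ω | ToBoundary ω w t} * P 1 p {ω | CrossedHoriz ω 0 w (3 * t)} ^ n := by
  induction n with
  | zero => simp [AccEv]
  | succ n ih =>
    rw [AccEv, sig_indep p (disj_LR (((n : ℤ) + 1) * w)) (accEv_meas w t n)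
      (crossEv_meas _ _ _ _ ?_), ih, P_crossEv, pow_succ, mul_assoc]
    intro b h1 h2 _ _ h5
    push_cast at h1 h2
    exact ⟨h1, h2, h5⟩

lemma path_shift {ω : Config 1} {v : ℕ → (Fin 1 → ℤ)} {t : ℕ} (h : IsPath ω v t) (c : ℤ) :
    IsPath (fun b => ω (shiftBond c b)) (fun j => v j - fun _ => c) t := by
  intro j hj
  have := h j hj
  simpa [shiftBond] using this

lemma path_rev {ω : Config 1} {v : ℕ → (Fin 1 → ℤ)} {t : ℕ} (h : IsPath ω v t) (c : ℤ) :
    IsPath (fun b => ω (revBond c t b)) (fun j => v (t - j) - fun _ => c) t := by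
  intro j hj
  have h1 := h (t - 1 - j) (by omega)
  have h2 : t - 1 - j + 1 = t - j := by omega
  have h3 : t - (j + 1) = t - 1 - j := by omega
  rw [h2] at h1
  simp only [h3]
  rw [norm1_one] at h1 ⊢
  refine ⟨?_, ?_⟩
  · rw [← h1.1]; simp only [Pi.sub_apply]; rw [abs_sub_comm]; congr 1; ring
  · simpa [revBond, hj] using h1.2

/-- for `d = 1`, any `p ∈ [0,1]`, `t ≥ 1` and any integer `w ≥ 1`,
with `B_o = [-w,w] × [0,t]` and `∂B_o = {(x,s) ∈ B_o : s = t or |x| = w}`, for all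
integers `j ≥ 2` and `x` with `j w < x ≤ (j+1) w` and `x + t` even,
`τ(x,t) ≤ ℙ_p((o,0) → ∂B_o)² H_p(w,3t)^{j-2}`. -/
theorem two_point_upper_bound_boundary (p : ℝ) (hp : p ∈ Set.Icc (0 : ℝ) 1)
    (t : ℕ) (ht : 1 ≤ t) (w : ℕ) (hw : 1 ≤ w)
    (j : ℕ) (hj : 2 ≤ j) (x : ℤ) (hx1 : (j : ℤ) * w < x) (hx2 : x ≤ ((j : ℤ) + 1) * w)
    (hpar : Even (x + (t : ℤ))) :
    tau 1 p (fun _ => x) t ≤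
      (P 1 p {ω | ToBoundary ω w t}).toReal ^ 2 * H p w (3 * t) ^ (j - 2) := by
  have hw' : (1 : ℤ) ≤ w := by exact_mod_cast hw
  have hj' : (2 : ℤ) ≤ j := by exact_mod_cast hj
  have hsub : {ω : Config 1 | Connected ω 0 0 (fun _ => x) t} ⊆
      AccEv w t (j - 2) ∩ RevEv w t x := by
    intro ω hω
    rcases hω with ⟨_, h, _⟩ | ⟨_, v, h0, h1, _, h2⟩
    · omega
    have hv : IsPath ω v t := fun i hi => h2 i (Nat.zero_le _) hi
    have hvt : v t 0 = x := by rw [h1]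
    have hv0 : v 0 0 = 0 := by rw [h0]; rfl
    have hwx : (w : ℤ) ≤ x := by nlinarith
    constructor
    · have : ∀ n ≤ j - 2, ω ∈ AccEv w t n := by
        intro n
        induction n with
        | zero =>
          intro _
          refine toBoundary_of_path hv w hw h0 ?_
          rw [hvt]; exact hwx.trans (le_abs_self x)
        | succ n ih =>
          intro hn
          refine ⟨ih (by omega), ?_⟩
          have hn' : (n : ℤ) + 2 ≤ j := by omega
          refine crossed_of_path (path_shift hv _) w (3 * t) (by omega) hw ?_ ?_
          · simp only [Pi.sub_apply, hv0]
            push_cast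
            nlinarith
          · simp only [Pi.sub_apply, hvt]
            push_cast
            nlinarith
      exact this _ le_rfl
    · refine toBoundary_of_path (path_rev hv x) w hw ?_ ?_
      · simp [h1]
      · simp only [Pi.sub_apply, Nat.sub_self, hv0]
        rw [zero_sub, abs_neg]
        exact hwx.trans (le_abs_self x)
  have hfin : P 1 p {ω : Config 1 | Connected ω 0 0 (fun _ => x) t} ≤
      P 1 p {ω | ToBoundary ω w t} ^ 2 *
        P 1 p {ω | CrossedHoriz ω 0 w (3 * t)} ^ (j - 2) := by
    refine (measure_mono hsub).trans (le_of_eq ?_)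
    have hc : (((j - 2 : ℕ) : ℤ) + 1) * w + w ≤ x := by
      have : ((j - 2 : ℕ) : ℤ) = j - 2 := by omega
      rw [this]; nlinarith
    rw [sig_indep p (disj_LR _) (accEv_meas w t (j - 2)) (revEv_meas w t x _ hc), P_accEv, P_revEv]
    ring
  haveI : IsProbabilityMeasure (P 1 p) := by rw [P_eq]; infer_instance
  have := ENNReal.toReal_mono (ENNReal.mul_ne_top (ENNReal.pow_ne_top (measure_ne_top _ _))
    (ENNReal.pow_ne_top (measure_ne_top _ _))) hfin
  rw [ENNReal.toReal_mul, ENNReal.toReal_pow, ENNReal.toReal_pow] at this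
  exact this

end OrientedPercolation
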